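/- Let k be a field, q ∈ k^*, and a ∈ k[h^{±1}] not a monomial. Then the center of the generalized Weyl algebra k[h^{±1}](σ_inv, a) with σ_inv(h) = q h^{-1} is generated as a k-algebra by h + q h^{-1}, x^2 and y^2, and is isomorphic to the commutative k-algebra k[t, X, Y]/(XY − b(t)), where b ∈ k[t] is the unique polynomial such that b(h + q h^{-1}) = a(h)·a(q h^{-1}) in k[h^{±1}] (such b exists because a(h)·a(q h^{-1}) is invariant under h ↦ q h^{-1}); equivalently, the center is isomorphic to the generalized Weyl algebra k[t](id, b). -/

import Mathlib

open LaurentPolynomial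

/-- The defining relations of the degree-one generalized Weyl algebra `k[h^{±1}](σ, a)`:
the generators `Sum.inl p` (for `p` a Laurent polynomial) give a copy of `k[h^{±1}]`,
and the generators `x = Sum.inr 0` and `y = Sum.inr 1` satisfy
`y x = a`, `x y = σ a`, `x r = σ(r) x` and `y r = σ⁻¹(r) y` for all `r ∈ k[h^{±1}]`. -/
inductive GWARel (k : Type*) [CommRing k] (σ : LaurentPolynomial k ≃ₐ[k] LaurentPolynomial k)
    (a : LaurentPolynomial k) :
    FreeAlgebra k (LaurentPolynomial k ⊕ Fin 2) →
      FreeAlgebra k (LaurentPolynomial k ⊕ Fin 2) → Prop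
  | add (r s : LaurentPolynomial k) :
      GWARel k σ a (FreeAlgebra.ι k (Sum.inl (r + s)))
        (FreeAlgebra.ι k (Sum.inl r) + FreeAlgebra.ι k (Sum.inl s))
  | mul (r s : LaurentPolynomial k) :
      GWARel k σ a (FreeAlgebra.ι k (Sum.inl (r * s)))
        (FreeAlgebra.ι k (Sum.inl r) * FreeAlgebra.ι k (Sum.inl s))
  | smul (c : k) (r : LaurentPolynomial k) :
      GWARel k σ a (FreeAlgebra.ι k (Sum.inl (c • r))) (c • FreeAlgebra.ι k (Sum.inl r))
  | one : GWARel k σ a (FreeAlgebra.ι k (Sum.inl 1)) 1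
  | xr (r : LaurentPolynomial k) :
      GWARel k σ a (FreeAlgebra.ι k (Sum.inr 0) * FreeAlgebra.ι k (Sum.inl r))
        (FreeAlgebra.ι k (Sum.inl (σ r)) * FreeAlgebra.ι k (Sum.inr 0))
  | yr (r : LaurentPolynomial k) :
      GWARel k σ a (FreeAlgebra.ι k (Sum.inr 1) * FreeAlgebra.ι k (Sum.inl r))
        (FreeAlgebra.ι k (Sum.inl (σ.symm r)) * FreeAlgebra.ι k (Sum.inr 1))
  | yx : GWARel k σ a (FreeAlgebra.ι k (Sum.inr 1) * FreeAlgebra.ι k (Sum.inr 0))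
        (FreeAlgebra.ι k (Sum.inl a))
  | xy : GWARel k σ a (FreeAlgebra.ι k (Sum.inr 0) * FreeAlgebra.ι k (Sum.inr 1))
        (FreeAlgebra.ι k (Sum.inl (σ a)))

/-- The degree-one generalized Weyl algebra `k[h^{±1}](σ, a)`, presented as the quotient of
the free algebra on `k[h^{±1}] ⊕ {x, y}` by the generalized Weyl relations. -/
abbrev GWA (k : Type*) [CommRing k] (σ : LaurentPolynomial k ≃ₐ[k] LaurentPolynomial k)
    (a : LaurentPolynomial k) :=
  RingQuot (GWARel k σ a)

namespace GWA

variable {k : Type*} [CommRing k] (σ : LaurentPolynomial k ≃ₐ[k] LaurentPolynomial k)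
  (a : LaurentPolynomial k)

/-- The copy of the Laurent polynomial `p` inside the generalized Weyl algebra. -/
noncomputable def r (p : LaurentPolynomial k) : GWA k σ a :=
  RingQuot.mkAlgHom k (GWARel k σ a) (FreeAlgebra.ι k (Sum.inl p))

/-- The element `h` of the generalized Weyl algebra. -/
noncomputable def H : GWA k σ a := r σ a (T 1)

/-- The element `h⁻¹` of the generalized Weyl algebra. -/
noncomputable def Hinv : GWA k σ a := r σ a (T (-1))

/-- The generator `x` of the generalized Weyl algebra. -/
noncomputable def x : GWA k σ a :=
  RingQuot.mkAlgHom k (GWARel k σ a) (FreeAlgebra.ι k (Sum.inr 0))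

/-- The generator `y` of the generalized Weyl algebra. -/
noncomputable def y : GWA k σ a :=
  RingQuot.mkAlgHom k (GWARel k σ a) (FreeAlgebra.ι k (Sum.inr 1))

end GWA

/-- An element `a ∈ k[h^{±1}]` is a monomial if `a = c·hⁱ` for some `c ∈ k`, `i ∈ ℤ`. -/
def LaurentPolynomial.IsMonomial {k : Type*} [CommRing k] (a : LaurentPolynomial k) : Prop :=
  ∃ (c : k) (i : ℤ), a = C c * T i

/-- Laurent-like expansion: if `A` is generated by a copy of `S` and elements `X`, `Y` that
skew-commute with `S` and satisfy `Y * X ∈ S`, `X * Y ∈ S`, then every element of `A` is a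
left `S`-linear combination of the powers of `X` and the powers of `Y`. -/
theorem exists_eq_sum_pow_mul_pow {k S A : Type*} [CommRing k] [CommRing S] [Algebra k S]
    [Ring A] [Algebra k A] (i : S →ₐ[k] A) (X Y : A) (τ τ' : S → S) (α β : S)
    (hX : ∀ s, X * i s = i (τ s) * X) (hY : ∀ s, Y * i s = i (τ' s) * Y)
    (hYX : Y * X = i α) (hXY : X * Y = i β)
    (hgen : Algebra.adjoin k (Set.range i ∪ {X, Y}) = ⊤) (u : A) :
    ∃ f : ℤ →₀ S, u = f.sum fun n s => i s * (X ^ n.toNat * Y ^ (-n).toNat) := by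
  let Φ : (ℤ →₀ S) →ₗ[k] A := Finsupp.lsum k fun n =>
    (LinearMap.mulRight k (X ^ n.toNat * Y ^ (-n).toNat)).comp i.toLinearMap
  have hsingle : ∀ n s, Φ (Finsupp.single n s) = i s * (X ^ n.toNat * Y ^ (-n).toNat) :=
    fun n s => Finsupp.sum_single_index (by simp)
  have hΦ : ∀ n s, i s * (X ^ n.toNat * Y ^ (-n).toNat) ∈ LinearMap.range Φ := fun n s =>
    ⟨Finsupp.single n s, hsingle n s⟩
  have closed : ∀ g : A, (∀ n s, g * (i s * (X ^ n.toNat * Y ^ (-n).toNat)) ∈ LinearMap.range Φ) →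
      ∀ v ∈ LinearMap.range Φ, g * v ∈ LinearMap.range Φ := by
    rintro g hg _ ⟨f, rfl⟩
    induction f using Finsupp.induction_linear with
    | zero => simp
    | add f₁ f₂ h₁ h₂ => rw [map_add, mul_add]; exact add_mem h₁ h₂
    | single n s => rw [hsingle]; exact hg n s
  have key : ∀ g : A, ∀ v ∈ LinearMap.range Φ, g * v ∈ LinearMap.range Φ := by
    intro g
    have hg : g ∈ Algebra.adjoin k (Set.range i ∪ {X, Y}) := hgen ▸ Algebra.mem_top
    induction hg using Algebra.adjoin_induction with
    | mem g hg =>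
      apply closed
      intro n s
      rcases hg with ⟨t, rfl⟩ | rfl | rfl
      · rw [← mul_assoc, ← map_mul]
        exact hΦ n _
      · rw [← mul_assoc, hX, mul_assoc]
        obtain ⟨m, rfl | rfl⟩ := n.eq_nat_or_neg
        · have := hΦ (m + 1 : ℤ) (τ s)
          rw [show (m + 1 : ℤ).toNat = m + 1 by omega,
            show (-(m + 1 : ℤ)).toNat = 0 by omega] at this
          simpa [pow_succ'] using this
        · cases m with
          | zero => simpa using hΦ 1 (τ s)
          | succ m =>
            have := hΦ (-m : ℤ) (τ s * β)
            simpa [pow_succ', mul_assoc, ← hXY, show (-1 + -(m : ℤ)).toNat = 0 by omega,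
              show (1 + (m : ℤ)).toNat = m + 1 by omega] using this
      · rw [← mul_assoc, hY, mul_assoc]
        obtain ⟨m, rfl | rfl⟩ := n.eq_nat_or_neg
        · cases m with
          | zero => simpa using hΦ (-1) (τ' s)
          | succ m =>
            have := hΦ (m : ℤ) (τ' s * α)
            simpa [pow_succ', mul_assoc, ← hYX, show (-1 + -(m : ℤ)).toNat = 0 by omega,
              show ((m : ℤ) + 1).toNat = m + 1 by omega] using this
        · have := hΦ (-(m + 1) : ℤ) (τ' s)
          rw [show (-(-(m + 1 : ℤ))).toNat = m + 1 by omega,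
            show (-(m + 1 : ℤ)).toNat = 0 by omega] at this
          simpa [pow_succ'] using this
    | algebraMap r =>
      intro v hv
      rw [← Algebra.smul_def]
      exact Submodule.smul_mem _ _ hv
    | add g₁ g₂ _ _ h₁ h₂ =>
      intro v hv
      rw [add_mul]
      exact add_mem (h₁ v hv) (h₂ v hv)
    | mul g₁ g₂ _ _ h₁ h₂ =>
      intro v hv
      rw [mul_assoc]
      exact h₁ _ (h₂ v hv)
  obtain ⟨f, hf⟩ := key u 1 (by simpa using hΦ 0 1)
  exact ⟨f, by rw [← mul_one u, ← hf]; rfl⟩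

namespace GWA

section General

variable {k : Type*} [CommRing k] (σ : LaurentPolynomial k ≃ₐ[k] LaurentPolynomial k)
  (a : LaurentPolynomial k)

/-- The structure map `k[h^{±1}] → k[h^{±1}](σ, a)`. -/
noncomputable def rHom : LaurentPolynomial k →ₐ[k] GWA k σ a :=
  AlgHom.ofLinearMap
    { toFun := r σ a
      map_add' := fun p s => by
        simp only [r]
        rw [RingQuot.mkAlgHom_rel k (GWARel.add p s), map_add]
      map_smul' := fun c p => by
        simp only [r, RingHom.id_apply]
        rw [RingQuot.mkAlgHom_rel k (GWARel.smul c p), map_smul] }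
    (by
      change RingQuot.mkAlgHom k _ _ = _
      rw [RingQuot.mkAlgHom_rel k GWARel.one, map_one])
    (fun p s => by
      change RingQuot.mkAlgHom k _ _ = _
      rw [RingQuot.mkAlgHom_rel k (GWARel.mul p s), map_mul]
      rfl)

theorem x_mul_rHom (p : LaurentPolynomial k) : x σ a * rHom σ a p = rHom σ a (σ p) * x σ a := by
  change RingQuot.mkAlgHom k _ _ * RingQuot.mkAlgHom k _ _ = _
  rw [← map_mul, RingQuot.mkAlgHom_rel k (GWARel.xr p), map_mul]
  rfl

theorem y_mul_rHom (p : LaurentPolynomial k) :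
    y σ a * rHom σ a p = rHom σ a (σ.symm p) * y σ a := by
  change RingQuot.mkAlgHom k _ _ * RingQuot.mkAlgHom k _ _ = _
  rw [← map_mul, RingQuot.mkAlgHom_rel k (GWARel.yr p), map_mul]
  rfl

theorem y_mul_x : y σ a * x σ a = rHom σ a a := by
  change RingQuot.mkAlgHom k _ _ * RingQuot.mkAlgHom k _ _ = _
  rw [← map_mul, RingQuot.mkAlgHom_rel k GWARel.yx]
  rfl

theorem x_mul_y : x σ a * y σ a = rHom σ a (σ a) := by
  change RingQuot.mkAlgHom k _ _ * RingQuot.mkAlgHom k _ _ = _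
  rw [← map_mul, RingQuot.mkAlgHom_rel k GWARel.xy]
  rfl

theorem adjoin_eq_top :
    Algebra.adjoin k (Set.range (rHom σ a) ∪ {x σ a, y σ a}) = ⊤ := by
  have hs := RingQuot.mkAlgHom_surjective k (GWARel k σ a)
  rw [← (AlgHom.range_eq_top _).2 hs, ← Algebra.map_top, ← FreeAlgebra.adjoin_range_ι,
    AlgHom.map_adjoin]
  congr 1
  ext u
  constructor
  · rintro (⟨p, rfl⟩ | rfl | rfl)
    · exact ⟨_, ⟨Sum.inl p, rfl⟩, rfl⟩
    · exact ⟨_, ⟨Sum.inr 0, rfl⟩, rfl⟩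
    · exact ⟨_, ⟨Sum.inr 1, rfl⟩, rfl⟩
  · rintro ⟨_, ⟨p | j, rfl⟩, rfl⟩
    · exact Or.inl ⟨p, rfl⟩
    · fin_cases j
      · exact Or.inr (Or.inl rfl)
      · exact Or.inr (Or.inr rfl)

theorem exists_eq_sum (u : GWA k σ a) : ∃ f : ℤ →₀ LaurentPolynomial k,
    u = f.sum fun n p => rHom σ a p * (x σ a ^ n.toNat * y σ a ^ (-n).toNat) :=
  exists_eq_sum_pow_mul_pow (rHom σ a) _ _ _ _ _ _ (x_mul_rHom σ a) (y_mul_rHom σ a)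
    (y_mul_x σ a) (x_mul_y σ a) (adjoin_eq_top σ a) u

/-- The action of the generators of `k[h^{±1}](σ, a)` on functions `ℤ → k[h^{±1}]`. -/
noncomputable def repGen :
    LaurentPolynomial k ⊕ Fin 2 → Module.End k (ℤ → LaurentPolynomial k)
  | Sum.inl p => LinearMap.pi fun n => LinearMap.mulLeft k p ∘ₗ LinearMap.proj n
  | Sum.inr 0 => LinearMap.pi fun n => σ.toLinearMap ∘ₗ LinearMap.proj (n - 1)
  | Sum.inr 1 => LinearMap.pi fun n =>
      LinearMap.mulLeft k a ∘ₗ σ.symm.toLinearMap ∘ₗ LinearMap.proj (n + 1)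

/-- The representation of `k[h^{±1}](σ, a)` on functions `ℤ → k[h^{±1}]`. -/
noncomputable def rep : GWA k σ a →ₐ[k] Module.End k (ℤ → LaurentPolynomial k) :=
  RingQuot.liftAlgHom k ⟨FreeAlgebra.lift k (repGen σ a), by
    intro u v h
    cases h <;> refine LinearMap.ext fun f => funext fun n => ?_ <;>
      simp [repGen, add_mul, mul_left_comm]⟩

theorem rep_rHom (p : LaurentPolynomial k) (f : ℤ → LaurentPolynomial k) (n : ℤ) :
    rep σ a (rHom σ a p) f n = p * f n := by
  change rep σ a (RingQuot.mkAlgHom k _ _) f n = _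
  rw [rep, RingQuot.liftAlgHom_mkAlgHom_apply, FreeAlgebra.lift_ι_apply]
  rfl

theorem rep_x (f : ℤ → LaurentPolynomial k) (n : ℤ) :
    rep σ a (x σ a) f n = σ (f (n - 1)) := by
  change rep σ a (RingQuot.mkAlgHom k _ _) f n = _
  rw [rep, RingQuot.liftAlgHom_mkAlgHom_apply, FreeAlgebra.lift_ι_apply]
  rfl

theorem rep_y (f : ℤ → LaurentPolynomial k) (n : ℤ) :
    rep σ a (y σ a) f n = a * σ.symm (f (n + 1)) := by
  change rep σ a (RingQuot.mkAlgHom k _ _) f n = _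
  rw [rep, RingQuot.liftAlgHom_mkAlgHom_apply, FreeAlgebra.lift_ι_apply]
  rfl

/-- The value of the representation on the vector `Pi.single 0 1`. -/
noncomputable def symb : GWA k σ a →ₗ[k] (ℤ → LaurentPolynomial k) :=
  (LinearMap.applyₗ (Pi.single 0 1)).comp (rep σ a).toLinearMap

theorem symb_apply (u : GWA k σ a) : symb σ a u = rep σ a u (Pi.single 0 1) := rfl

/-- The coefficient `a σ⁻¹(a) ⋯ σ^{-(m-1)}(a)` by which `y ^ m` acts on `Pi.single 0 1`. -/
noncomputable def yCoeff : ℕ → LaurentPolynomial k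
  | 0 => 1
  | m + 1 => a * σ.symm (yCoeff m)

theorem rep_y_pow_single (m : ℕ) :
    rep σ a (y σ a ^ m) (Pi.single 0 1) = Pi.single (-m : ℤ) (yCoeff σ a m) := by
  induction m with
  | zero => simp [yCoeff]
  | succ m ih =>
    ext1 n
    rw [pow_succ', map_mul, Module.End.mul_apply, ih, rep_y, yCoeff]
    by_cases h : n = -((m + 1 : ℕ) : ℤ)
    · subst h
      rw [Pi.single_eq_same, show -((m + 1 : ℕ) : ℤ) + 1 = -m by push_cast; ring,
        Pi.single_eq_same]
    · rw [Pi.single_eq_of_ne h, Pi.single_eq_of_ne (by push_cast at h; omega)]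
      simp

theorem rep_x_pow_single (m : ℕ) :
    rep σ a (x σ a ^ m) (Pi.single 0 1) = Pi.single (m : ℤ) 1 := by
  induction m with
  | zero => simp
  | succ m ih =>
    ext1 n
    rw [pow_succ', map_mul, Module.End.mul_apply, ih, rep_x]
    by_cases h : n = ((m + 1 : ℕ) : ℤ)
    · subst h
      rw [Pi.single_eq_same, show ((m + 1 : ℕ) : ℤ) - 1 = m by push_cast; ring,
        Pi.single_eq_same, map_one]
    · rw [Pi.single_eq_of_ne h, Pi.single_eq_of_ne (by push_cast at h; omega), map_zero]

theorem symb_pow_mul_pow (n : ℤ) :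
    symb σ a (x σ a ^ n.toNat * y σ a ^ (-n).toNat) =
      Pi.single n (yCoeff σ a (-n).toNat) := by
  rw [symb_apply]
  obtain ⟨m, rfl | rfl⟩ := n.eq_nat_or_neg
  · simpa [yCoeff] using rep_x_pow_single σ a m
  · simpa using rep_y_pow_single σ a m

theorem symb_rHom_mul (p : LaurentPolynomial k) (u : GWA k σ a) (n : ℤ) :
    symb σ a (rHom σ a p * u) n = p * symb σ a u n := by
  rw [symb_apply, map_mul, Module.End.mul_apply, rep_rHom, symb_apply]

theorem symb_sum (f : ℤ →₀ LaurentPolynomial k) (n : ℤ) :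
    symb σ a (f.sum fun n p => rHom σ a p * (x σ a ^ n.toNat * y σ a ^ (-n).toNat)) n =
      f n * yCoeff σ a (-n).toNat := by
  rw [Finsupp.sum, map_sum, Finset.sum_apply]
  simp only [symb_rHom_mul, symb_pow_mul_pow]
  rw [Finset.sum_eq_single n]
  · rw [Pi.single_eq_same]
  · intro m _ hm
    rw [Pi.single_eq_of_ne' hm, mul_zero]
  · intro hn
    rw [Finsupp.notMem_support_iff.1 hn, zero_mul]

/-- Operators on functions `ℤ → k[h^{±1}]` commuting with the generators commute with the
representation. -/
theorem rep_comm (ρ : Module.End k (ℤ → LaurentPolynomial k))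
    (hr : ∀ p, Commute (rep σ a (rHom σ a p)) ρ) (hx : Commute (rep σ a (x σ a)) ρ)
    (hy : Commute (rep σ a (y σ a)) ρ) (u : GWA k σ a) : Commute (rep σ a u) ρ := by
  have hu : u ∈ Algebra.adjoin k (Set.range (rHom σ a) ∪ {x σ a, y σ a}) :=
    adjoin_eq_top σ a ▸ Algebra.mem_top
  induction hu using Algebra.adjoin_induction with
  | mem g hg =>
    rcases hg with ⟨t, rfl⟩ | rfl | rfl
    exacts [hr t, hx, hy]
  | algebraMap c => rw [AlgHom.commutes]; exact Algebra.commutes c ρ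
  | add g₁ g₂ _ _ h₁ h₂ => rw [map_add]; exact h₁.add_left h₂
  | mul g₁ g₂ _ _ h₁ h₂ => rw [map_mul]; exact h₁.mul_left h₂

/-- Central elements are those commuting with `k[h^{±1}]`, `x` and `y`. -/
theorem mem_center_of_commute (u : GWA k σ a) (hr : ∀ p, Commute (rHom σ a p) u)
    (hx : Commute (x σ a) u) (hy : Commute (y σ a) u) :
    u ∈ Subalgebra.center k (GWA k σ a) := by
  rw [Subalgebra.mem_center_iff]
  intro v
  have hv : v ∈ Algebra.adjoin k (Set.range (rHom σ a) ∪ {x σ a, y σ a}) :=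
    adjoin_eq_top σ a ▸ Algebra.mem_top
  change Commute v u
  induction hv using Algebra.adjoin_induction with
  | mem g hg =>
    rcases hg with ⟨t, rfl⟩ | rfl | rfl
    exacts [hr t, hx, hy]
  | algebraMap c => exact Algebra.commutes c u
  | add g₁ g₂ _ _ h₁ h₂ => exact h₁.add_left h₂
  | mul g₁ g₂ _ _ h₁ h₂ => exact h₁.mul_left h₂

end General

section Invariants

theorem _root_.LaurentPolynomial.exists_eq_aeval_add_aeval_mul_T {k : Type*} [Field k] {q : k}
    (hq : q ≠ 0) (f : LaurentPolynomial k) :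
    ∃ P Q : Polynomial k, f = Polynomial.aeval (T 1 + C q * T (-1)) P +
      Polynomial.aeval (T 1 + C q * T (-1)) Q * T 1 := by
  have hT : (T 1 * T (-1) : LaurentPolynomial k) = 1 := by
    rw [← LaurentPolynomial.T_add]; simp
  have hC : (C q * C q⁻¹ : LaurentPolynomial k) = 1 := by
    rw [← map_mul, mul_inv_cancel₀ hq, map_one]
  induction f using LaurentPolynomial.induction_on with
  | h_C c => exact ⟨Polynomial.C c, 0, by
      rw [Polynomial.aeval_C, map_zero, zero_mul, add_zero, C_eq_algebraMap]⟩
  | h_add h₁ h₂ =>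
    obtain ⟨P₁, Q₁, rfl⟩ := h₁
    obtain ⟨P₂, Q₂, rfl⟩ := h₂
    exact ⟨P₁ + P₂, Q₁ + Q₂, by simp only [map_add]; ring⟩
  | h_C_mul_T n c h =>
    obtain ⟨P, Q, h⟩ := h
    refine ⟨-(Polynomial.C q * Q), P + Q * Polynomial.X, ?_⟩
    rw [LaurentPolynomial.T_add, ← mul_assoc, h]
    simp only [map_add, map_mul, map_neg, Polynomial.aeval_X, Polynomial.aeval_C,
      ← C_eq_algebraMap]
    linear_combination (-C q * Polynomial.aeval (T 1 + C q * T (-1)) Q) * hT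
  | h_C_mul_T_Z n c h =>
    obtain ⟨P, Q, h⟩ := h
    refine ⟨Q + Polynomial.C q⁻¹ * (P * Polynomial.X), -(Polynomial.C q⁻¹ * P), ?_⟩
    rw [LaurentPolynomial.T_sub, ← mul_assoc, h]
    simp only [map_add, map_mul, map_neg, Polynomial.aeval_X, Polynomial.aeval_C,
      ← C_eq_algebraMap]
    linear_combination (Polynomial.aeval (T 1 + C q * T (-1)) Q) * hT -
      (Polynomial.aeval (T 1 + C q * T (-1)) P * T (-1)) * hC

theorem _root_.LaurentPolynomial.aeval_T_add_injective {k : Type*} [Field k] (q : k) :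
    Function.Injective (Polynomial.aeval (R := k)
      (T 1 + LaurentPolynomial.C q * T (-1) : LaurentPolynomial k)) := by
  rw [← transcendental_iff_injective]
  intro ht
  have ht := ht.isIntegral
  have hT : (T 1 * T (-1) : LaurentPolynomial k) = 1 := by rw [← T_add]; simp
  have : IsIntegral (integralClosure k (LaurentPolynomial k)) (T 1 : LaurentPolynomial k) := by
    refine ⟨Polynomial.X ^ 2 - Polynomial.C ⟨_, ht⟩ * Polynomial.X +
      Polynomial.C (algebraMap k _ q), ?_, ?_⟩
    · monicity!
    · simp only [Polynomial.eval₂_add, Polynomial.eval₂_sub, Polynomial.eval₂_mul,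
        Polynomial.eval₂_C, Polynomial.eval₂_X, Polynomial.eval₂_X_pow,
        ← IsScalarTower.algebraMap_apply, ← C_eq_algebraMap]
      change T 1 ^ 2 - (T 1 + LaurentPolynomial.C q * T (-1)) * T 1 + LaurentPolynomial.C q = 0
      linear_combination (-LaurentPolynomial.C q) * hT
  have h : IsIntegral k (T 1 : LaurentPolynomial k) := isIntegral_trans _ this
  obtain ⟨p, hp, hp0⟩ := h
  refine hp.ne_zero (Polynomial.toLaurent_injective ?_)
  rw [map_zero, ← hp0, ← Polynomial.aeval_def, ← Polynomial.toLaurent_X,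
    ← Polynomial.coe_toLaurentAlg, Polynomial.aeval_algHom_apply, Polynomial.aeval_X_left_apply]

variable {k : Type*} [Field k] {q : k} {σ : LaurentPolynomial k ≃ₐ[k] LaurentPolynomial k}

theorem sigma_C (c : k) : σ (C c) = C c := by
  rw [C_eq_algebraMap, AlgEquiv.commutes]

theorem sigma_T_neg_one (hq : q ≠ 0) (hσ : σ (T 1) = C q * T (-1)) :
    σ (T (-1)) = C q⁻¹ * T 1 := by
  have hT : (T 1 * T (-1) : LaurentPolynomial k) = 1 := by rw [← T_add]; simp
  have hC : (C q * C q⁻¹ : LaurentPolynomial k) = 1 := by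
    rw [← map_mul, mul_inv_cancel₀ hq, map_one]
  have h := congrArg σ hT
  rw [map_mul, hσ, map_one] at h
  linear_combination (C q⁻¹ * T 1) * h - σ (T (-1)) * hT - σ (T (-1)) * T 1 * T (-1) * hC

theorem sigma_aeval (hq : q ≠ 0) (hσ : σ (T 1) = C q * T (-1)) (P : Polynomial k) :
    σ (Polynomial.aeval (T 1 + C q * T (-1)) P) = Polynomial.aeval (T 1 + C q * T (-1)) P := by
  have hC : (C q * C q⁻¹ : LaurentPolynomial k) = 1 := by
    rw [← map_mul, mul_inv_cancel₀ hq, map_one]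
  rw [← Polynomial.aeval_algHom_apply, map_add, map_mul, sigma_C, hσ, sigma_T_neg_one hq hσ,
    ← mul_assoc, hC, one_mul, add_comm]

theorem sigma_sigma (hq : q ≠ 0) (hσ : σ (T 1) = C q * T (-1)) (f : LaurentPolynomial k) :
    σ (σ f) = f := by
  obtain ⟨P, Q, rfl⟩ := LaurentPolynomial.exists_eq_aeval_add_aeval_mul_T hq f
  have hC : (C q * C q⁻¹ : LaurentPolynomial k) = 1 := by
    rw [← map_mul, mul_inv_cancel₀ hq, map_one]
  simp only [map_add, map_mul, sigma_aeval hq hσ, hσ, sigma_C, sigma_T_neg_one hq hσ]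
  rw [← mul_assoc (C q), hC, one_mul]

theorem sigma_T_one_ne (hσ : σ (T 1) = C q * T (-1)) : σ (T 1) ≠ T 1 := by
  intro h
  rw [hσ] at h
  have := congrArg (fun p => AddMonoidAlgebra.coeff p 1) h
  rw [← single_eq_C_mul_T] at this
  simp [-single_eq_C_mul_T] at this

theorem exists_aeval_of_sigma_eq (hq : q ≠ 0) (hσ : σ (T 1) = C q * T (-1))
    {f : LaurentPolynomial k} (hf : σ f = f) :
    ∃ P : Polynomial k, f = Polynomial.aeval (T 1 + C q * T (-1)) P := by
  obtain ⟨P, Q, rfl⟩ := LaurentPolynomial.exists_eq_aeval_add_aeval_mul_T hq f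
  rw [map_add, map_mul, sigma_aeval hq hσ, sigma_aeval hq hσ, add_right_inj] at hf
  have hQ : Polynomial.aeval (T 1 + C q * T (-1)) Q * (σ (T 1) - T 1) = 0 := by
    rw [mul_sub, hf, sub_self]
  rw [mul_eq_zero, sub_eq_zero, or_iff_left (sigma_T_one_ne hσ)] at hQ
  exact ⟨P, by rw [hQ, zero_mul, add_zero]⟩

end Invariants

section Center

variable {k : Type*} [Field k] {q : k} {σ : LaurentPolynomial k ≃ₐ[k] LaurentPolynomial k}
  {a : LaurentPolynomial k}

theorem sigma_symm (hq : q ≠ 0) (hσ : σ (T 1) = C q * T (-1)) (f : LaurentPolynomial k) :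
    σ.symm f = σ f := by
  rw [AlgEquiv.symm_apply_eq, sigma_sigma hq hσ]

theorem yCoeff_ne_zero (ha : a ≠ 0) (m : ℕ) : yCoeff σ a m ≠ 0 := by
  induction m with
  | zero => exact one_ne_zero
  | succ m ih => exact mul_ne_zero ha (by simpa using ih)

theorem sigma_yCoeff_two_mul (hq : q ≠ 0) (hσ : σ (T 1) = C q * T (-1)) (m : ℕ) :
    σ (yCoeff σ a (2 * m)) = yCoeff σ a (2 * m) := by
  induction m with
  | zero => exact map_one σ
  | succ m ih =>
    rw [show 2 * (m + 1) = 2 * m + 1 + 1 by ring, yCoeff, yCoeff]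
    simp only [sigma_symm hq hσ, map_mul, sigma_sigma hq hσ, ih]
    ring

theorem symb_eq_zero_of_odd (hq : q ≠ 0) (hσ : σ (T 1) = C q * T (-1)) {u : GWA k σ a}
    (hu : u ∈ Subalgebra.center k (GWA k σ a)) {n : ℤ} (hn : Odd n) : symb σ a u n = 0 := by
  let ε : ℤ → LaurentPolynomial k := fun n => if Even n then T 1 else σ (T 1)
  have hε : ∀ n, σ (ε n) = ε (n + 1) := by
    intro n
    by_cases h : Even n
    · simp [ε, h]
    · simp [ε, h, sigma_sigma hq hσ]
  let ρ : Module.End k (ℤ → LaurentPolynomial k) :=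
    LinearMap.pi fun n => LinearMap.mulRight k (ε n) ∘ₗ LinearMap.proj n
  have hρ : ∀ f n, ρ f n = f n * ε n := fun f n => rfl
  have hcomm := rep_comm σ a ρ
    (fun p => LinearMap.ext fun f => funext fun n => by
      simp only [Module.End.mul_apply, rep_rHom, hρ, mul_assoc])
    (LinearMap.ext fun f => funext fun n => by
      simp only [Module.End.mul_apply, rep_x, hρ, map_mul, hε, sub_add_cancel])
    (LinearMap.ext fun f => funext fun n => by
      simp only [Module.End.mul_apply, rep_y, hρ, map_mul, sigma_symm hq hσ, hε, mul_assoc]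
      simp only [ε, Int.even_add_one, not_not]) u
  have h₁ : rep σ a (rHom σ a (T 1)) (Pi.single 0 1) = ρ (Pi.single 0 1) := by
    ext1 m
    rw [rep_rHom, hρ]
    by_cases hm : m = 0
    · subst hm; simp [ε]
    · simp [Pi.single_eq_of_ne hm]
  have h₂ := congrFun (congrArg (symb σ a)
    (Subalgebra.mem_center_iff.1 hu (rHom σ a (T 1)))) n
  rw [symb_rHom_mul, symb_apply σ a (u * _), map_mul, Module.End.mul_apply, h₁,
    ← Module.End.mul_apply, hcomm.eq, Module.End.mul_apply, hρ, ← symb_apply] at h₂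
  have h₃ : symb σ a u n * (σ (T 1) - T 1) = 0 := by
    simp only [ε, if_neg (Int.not_even_iff_odd.2 hn)] at h₂
    linear_combination -h₂
  rwa [mul_eq_zero, sub_eq_zero, or_iff_left (sigma_T_one_ne hσ)] at h₃

theorem sigma_symb {u : GWA k σ a} (hu : u ∈ Subalgebra.center k (GWA k σ a)) (n : ℤ) :
    σ (symb σ a u n) = symb σ a u n := by
  let ρ : Module.End k (ℤ → LaurentPolynomial k) :=
    LinearMap.pi fun n => LinearMap.proj (n - 1)
  have hρ : ∀ f n, ρ f n = f (n - 1) := fun f n => rfl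
  have hcomm := rep_comm σ a ρ
    (fun p => LinearMap.ext fun f => funext fun n => by
      simp only [Module.End.mul_apply, rep_rHom, hρ])
    (LinearMap.ext fun f => funext fun n => by
      simp only [Module.End.mul_apply, rep_x, hρ])
    (LinearMap.ext fun f => funext fun n => by
      simp only [Module.End.mul_apply, rep_y, hρ, sub_add_cancel, add_sub_cancel_right]) u
  have h₁ : rep σ a (x σ a) (Pi.single 0 1) = ρ (Pi.single 0 1) := by
    ext1 m
    rw [rep_x, hρ]
    by_cases hm : m - 1 = 0
    · rw [hm]; simp
    · simp [Pi.single_eq_of_ne hm]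
  have h₂ := congrFun (congrArg (symb σ a)
    (Subalgebra.mem_center_iff.1 hu (x σ a))) (n + 1)
  rw [symb_apply, symb_apply, map_mul, map_mul, Module.End.mul_apply, Module.End.mul_apply, h₁,
    ← Module.End.mul_apply (rep σ a u), hcomm.eq, Module.End.mul_apply, hρ, rep_x,
    ← symb_apply, add_sub_cancel_right] at h₂
  exact h₂

theorem H_add_eq : H σ a + algebraMap k (GWA k σ a) q * Hinv σ a =
    rHom σ a (T 1 + C q * T (-1)) := by
  rw [map_add, map_mul, C_eq_algebraMap, AlgHom.commutes]
  rfl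

theorem pow_two_mul_mul_pow (n : ℤ) : x σ a ^ (2 * n).toNat * y σ a ^ (-(2 * n)).toNat =
    (x σ a * x σ a) ^ n.toNat * (y σ a * y σ a) ^ (-n).toNat := by
  rw [← pow_two, ← pow_two, ← pow_mul, ← pow_mul, show (2 * n).toNat = 2 * n.toNat by omega,
    show (-(2 * n)).toNat = 2 * (-n).toNat by omega]

theorem rHom_add_mem_center (hq : q ≠ 0) (hσ : σ (T 1) = C q * T (-1)) :
    rHom σ a (T 1 + C q * T (-1)) ∈ Subalgebra.center k (GWA k σ a) := by
  have h : σ (T 1 + C q * T (-1)) = T 1 + C q * T (-1) := by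
    simpa using sigma_aeval hq hσ Polynomial.X
  apply mem_center_of_commute
  · intro p
    rw [Commute, SemiconjBy, ← map_mul, ← map_mul, mul_comm]
  · rw [Commute, SemiconjBy, x_mul_rHom, h]
  · rw [Commute, SemiconjBy, y_mul_rHom, sigma_symm hq hσ, h]

theorem x_mul_x_mem_center (hq : q ≠ 0) (hσ : σ (T 1) = C q * T (-1)) :
    x σ a * x σ a ∈ Subalgebra.center k (GWA k σ a) := by
  apply mem_center_of_commute
  · intro p
    rw [Commute, SemiconjBy, mul_assoc (x σ a) (x σ a) (rHom σ a p), x_mul_rHom,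
      ← mul_assoc (x σ a) (rHom σ a (σ p)), x_mul_rHom,
      sigma_sigma hq hσ, mul_assoc]
  · exact (Commute.refl _).mul_right (Commute.refl _)
  · rw [Commute, SemiconjBy, ← mul_assoc, y_mul_x, mul_assoc (x σ a), x_mul_y, x_mul_rHom,
      sigma_sigma hq hσ]

theorem y_mul_y_mem_center (hq : q ≠ 0) (hσ : σ (T 1) = C q * T (-1)) :
    y σ a * y σ a ∈ Subalgebra.center k (GWA k σ a) := by
  apply mem_center_of_commute
  · intro p
    rw [Commute, SemiconjBy, mul_assoc (y σ a) (y σ a) (rHom σ a p), y_mul_rHom,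
      ← mul_assoc (y σ a) (rHom σ a (σ.symm p)), y_mul_rHom,
      sigma_symm hq hσ, sigma_symm hq hσ, sigma_sigma hq hσ, mul_assoc]
  · rw [Commute, SemiconjBy, ← mul_assoc, x_mul_y, mul_assoc (y σ a), y_mul_x, y_mul_rHom,
      sigma_symm hq hσ]
  · exact (Commute.refl _).mul_right (Commute.refl _)

theorem x_mul_x_mul_y_mul_y (hq : q ≠ 0) (hσ : σ (T 1) = C q * T (-1)) :
    x σ a * x σ a * (y σ a * y σ a) = rHom σ a (a * σ a) := by
  rw [mul_assoc, ← mul_assoc (x σ a) (y σ a), x_mul_y, ← mul_assoc, x_mul_rHom,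
    sigma_sigma hq hσ, mul_assoc, x_mul_y, map_mul]

theorem adjoin_eq_center (hq : q ≠ 0) (hσ : σ (T 1) = C q * T (-1)) (ha : a ≠ 0) :
    Algebra.adjoin k ({H σ a + algebraMap k (GWA k σ a) q * Hinv σ a, x σ a * x σ a,
      y σ a * y σ a} : Set (GWA k σ a)) = Subalgebra.center k (GWA k σ a) := by
  rw [H_add_eq]
  apply le_antisymm
  · rw [Algebra.adjoin_le_iff]
    rintro _ (rfl | rfl | rfl)
    exacts [rHom_add_mem_center hq hσ, x_mul_x_mem_center hq hσ, y_mul_y_mem_center hq hσ]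
  · intro u hu
    obtain ⟨f, rfl⟩ := exists_eq_sum σ a u
    refine Subalgebra.sum_mem _ fun n _ => ?_
    obtain ⟨m, rfl | rfl⟩ := n.even_or_odd'
    · have h := sigma_symb hu (2 * m)
      rw [symb_sum, map_mul, show (-(2 * m)).toNat = 2 * (-m).toNat by omega,
        sigma_yCoeff_two_mul hq hσ] at h
      obtain ⟨P, hP⟩ := exists_aeval_of_sigma_eq hq hσ (mul_right_cancel₀ (yCoeff_ne_zero ha _) h)
      beta_reduce
      rw [hP, ← Polynomial.aeval_algHom_apply, pow_two_mul_mul_pow]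
      refine mul_mem ?_ (mul_mem (pow_mem (Algebra.subset_adjoin (by simp)) _)
        (pow_mem (Algebra.subset_adjoin (by simp)) _))
      exact Algebra.adjoin_mono (by simp) (Polynomial.aeval_mem_adjoin_singleton k _)
    · have h := symb_eq_zero_of_odd hq hσ hu (odd_two_mul_add_one m)
      rw [symb_sum, mul_eq_zero, or_iff_left (yCoeff_ne_zero ha _)] at h
      beta_reduce
      rw [h, map_zero, zero_mul]
      exact zero_mem _

/-- Each element of `k[t, X, Y]/(X Y - b(t))` is a `k[t]`-combination of powers of `X` and
powers of `Y`. -/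
theorem _root_.MvPolynomial.exists_quotient_eq_sum (b : Polynomial k)
    {I : Ideal (MvPolynomial (Fin 3) k)} (hI : MvPolynomial.X 1 * MvPolynomial.X 2 -
      Polynomial.aeval (MvPolynomial.X 0 : MvPolynomial (Fin 3) k) b ∈ I)
    (z : MvPolynomial (Fin 3) k ⧸ I) :
    ∃ f : ℤ →₀ Polynomial k, z = f.sum fun n p =>
      Polynomial.aeval (Ideal.Quotient.mkₐ k I (MvPolynomial.X 0)) p *
        (Ideal.Quotient.mkₐ k I (MvPolynomial.X 1) ^ n.toNat *
          Ideal.Quotient.mkₐ k I (MvPolynomial.X 2) ^ (-n).toNat) := by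
  have hXY : Ideal.Quotient.mkₐ k I (MvPolynomial.X 1) * Ideal.Quotient.mkₐ k I (MvPolynomial.X 2)
      = Polynomial.aeval (Ideal.Quotient.mkₐ k I (MvPolynomial.X 0)) b := by
    rw [Polynomial.aeval_algHom_apply, ← map_mul]
    exact Ideal.Quotient.eq.2 hI
  refine exists_eq_sum_pow_mul_pow (Polynomial.aeval _) _ _ id id b b
    (fun s => mul_comm _ _) (fun s => mul_comm _ _) ((mul_comm _ _).trans hXY) hXY ?_ z
  rw [eq_top_iff, ← (AlgHom.range_eq_top _).2 (Ideal.Quotient.mkₐ_surjective k I),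
    ← Algebra.map_top, ← MvPolynomial.adjoin_range_X, AlgHom.map_adjoin]
  refine Algebra.adjoin_mono ?_
  rintro _ ⟨_, ⟨j, rfl⟩, rfl⟩
  fin_cases j
  · exact Or.inl ⟨Polynomial.X, Polynomial.aeval_X _⟩
  · exact Or.inr (Or.inl rfl)
  · exact Or.inr (Or.inr rfl)

theorem nonempty_center_algEquiv (hq : q ≠ 0) (hσ : σ (T 1) = C q * T (-1)) (ha : a ≠ 0)
    {b : Polynomial k} (hb : Polynomial.aeval (T 1 + C q * T (-1)) b = a * σ a) :
    Nonempty (Subalgebra.center k (GWA k σ a) ≃ₐ[k]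
      (MvPolynomial (Fin 3) k ⧸ Ideal.span {MvPolynomial.X 1 * MvPolynomial.X 2 -
        Polynomial.aeval (MvPolynomial.X 0 : MvPolynomial (Fin 3) k) b})) := by
  let c : Fin 3 → Subalgebra.center k (GWA k σ a) :=
    ![⟨_, rHom_add_mem_center hq hσ⟩, ⟨_, x_mul_x_mem_center hq hσ⟩,
      ⟨_, y_mul_y_mem_center hq hσ⟩]
  have hker : ∀ p ∈ Ideal.span {MvPolynomial.X 1 * MvPolynomial.X 2 -
      Polynomial.aeval (MvPolynomial.X 0 : MvPolynomial (Fin 3) k) b},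
      MvPolynomial.aeval c p = 0 := by
    change _ ≤ RingHom.ker (MvPolynomial.aeval c)
    rw [Ideal.span_singleton_le_iff_mem, RingHom.mem_ker, map_sub, map_mul,
      ← Polynomial.aeval_algHom_apply, sub_eq_zero]
    simp only [MvPolynomial.aeval_X]
    apply Subtype.ext
    rw [← Subalgebra.coe_val, ← Polynomial.aeval_algHom_apply]
    change x σ a * x σ a * (y σ a * y σ a) = Polynomial.aeval (rHom σ a (T 1 + C q * T (-1))) b
    rw [x_mul_x_mul_y_mul_y hq hσ, Polynomial.aeval_algHom_apply, hb]
  let Θ := Ideal.Quotient.liftₐ (Ideal.span {MvPolynomial.X 1 * MvPolynomial.X 2 -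
    Polynomial.aeval (MvPolynomial.X 0 : MvPolynomial (Fin 3) k) b}) (MvPolynomial.aeval c) hker
  have hΘ : ∀ p, Θ (Ideal.Quotient.mkₐ k _ p) = MvPolynomial.aeval c p := fun p => rfl
  refine ⟨(AlgEquiv.ofBijective Θ ⟨?_, ?_⟩).symm⟩
  · rw [injective_iff_map_eq_zero]
    intro z hz
    obtain ⟨f, rfl⟩ := MvPolynomial.exists_quotient_eq_sum b (Ideal.mem_span_singleton_self _) z
    suffices f = 0 by rw [this, Finsupp.sum_zero_index]
    let g : ℤ →₀ LaurentPolynomial k :=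
      (f.mapRange _ (map_zero (Polynomial.aeval (R := k) (T 1 + C q * T (-1))))).embDomain
        ⟨fun n => 2 * n, mul_right_injective₀ two_ne_zero⟩
    have hg : g.sum (fun n p => rHom σ a p * (x σ a ^ n.toNat * y σ a ^ (-n).toNat)) = 0 := by
      rw [Finsupp.sum_embDomain, Finsupp.sum_mapRange_index (by simp)]
      rw [← ZeroMemClass.coe_zero (Subalgebra.center k (GWA k σ a)), ← hz, Finsupp.sum, Finsupp.sum,
        map_sum, ← Subalgebra.coe_val, map_sum]
      refine Finset.sum_congr rfl fun n _ => ?_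
      rw [Function.Embedding.coeFn_mk, pow_two_mul_mul_pow]
      simp only [map_mul, map_pow, ← Polynomial.aeval_algHom_apply, hΘ, MvPolynomial.aeval_X]
      rfl
    ext1 n
    have h := symb_sum σ a g (2 * n)
    rw [hg, map_zero, Pi.zero_apply, eq_comm, mul_eq_zero,
      or_iff_left (yCoeff_ne_zero ha _)] at h
    have h' : g (2 * n) = Polynomial.aeval (T 1 + C q * T (-1)) (f n) :=
      Finsupp.embDomain_apply_self _ _ n
    rw [h'] at h
    exact LaurentPolynomial.aeval_T_add_injective q (by rw [h, Finsupp.zero_apply, map_zero])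
  · rintro ⟨u, hu⟩
    have hle : Subalgebra.center k (GWA k σ a) ≤
        Θ.range.map (Subalgebra.center k (GWA k σ a)).val := by
      refine (adjoin_eq_center hq hσ ha).ge.trans ?_
      rw [H_add_eq, Algebra.adjoin_le_iff]
      rintro _ (rfl | rfl | rfl)
      exacts [⟨c 0, ⟨Ideal.Quotient.mkₐ k _ (MvPolynomial.X 0),
          (hΘ _).trans (MvPolynomial.aeval_X c 0)⟩, rfl⟩,
        ⟨c 1, ⟨Ideal.Quotient.mkₐ k _ (MvPolynomial.X 1),
          (hΘ _).trans (MvPolynomial.aeval_X c 1)⟩, rfl⟩,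
        ⟨c 2, ⟨Ideal.Quotient.mkₐ k _ (MvPolynomial.X 2),
          (hΘ _).trans (MvPolynomial.aeval_X c 2)⟩, rfl⟩]
    obtain ⟨v, ⟨z, hz⟩, hv⟩ := hle hu
    exact ⟨z, hz.trans (Subtype.ext hv)⟩

end Center

end GWA

/-- For `q ∈ k^*` and `a` not a monomial, the center of
`k[h^{±1}](σ_inv, a)` with `σ_inv(h) = q h⁻¹` is generated as a `k`-algebra by `h + q h⁻¹`,
`x²` and `y²`, and for the (unique) polynomial `b` with `b(h + q h⁻¹) = a(h)·a(q h⁻¹)` the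
center is isomorphic to `k[t, X, Y]/(X Y − b(t))`, i.e. to the generalized Weyl algebra
`k[t](id, b)`. -/
theorem center_involution_gwa (k : Type*) [Field k] (q : k) (hq : q ≠ 0)
    (σ : LaurentPolynomial k ≃ₐ[k] LaurentPolynomial k) (hσ : σ (T 1) = C q * T (-1))
    (a : LaurentPolynomial k) (ha : ¬ a.IsMonomial) :
    Algebra.adjoin k
        ({GWA.H σ a + algebraMap k (GWA k σ a) q * GWA.Hinv σ a,
            GWA.x σ a * GWA.x σ a, GWA.y σ a * GWA.y σ a} : Set (GWA k σ a)) =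
        Subalgebra.center k (GWA k σ a) ∧
      ∀ b : Polynomial k, Polynomial.aeval (T 1 + C q * T (-1)) b = a * σ a →
        Nonempty
          (Subalgebra.center k (GWA k σ a) ≃ₐ[k]
            (MvPolynomial (Fin 3) k ⧸
              Ideal.span {MvPolynomial.X 1 * MvPolynomial.X 2 -
                Polynomial.aeval (MvPolynomial.X 0 : MvPolynomial (Fin 3) k) b})) := by
  have ha0 : a ≠ 0 := fun h => ha ⟨0, 0, by rw [h, map_zero, zero_mul]⟩
  exact ⟨GWA.adjoin_eq_center hq hσ ha0, fun b hb => GWA.nonempty_center_algEquiv hq hσ ha0 hb⟩
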